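/- For every w ∈ (0, ∞], the explicit map Q₀ = Q_{0,w}(x) = s_*(w/(3+w))(1/r³)(e_r⊗e_r − I/3) + s_*(1 − (w/(1+w))(1/r))(e_z⊗e_z − I/3), with r = |x| and e_r = x/|x|, belongs to H_∞ (i.e. Q₀ − Q_∞ has finite Dirichlet integral and finite Hardy integral on Ω), each matrix entry of Q₀ is a harmonic function on Ω, and on the unit sphere Q₀ satisfies the Robin boundary condition (1/w) ∂Q₀/∂ν = Q_s − Q₀, where ν = −e_r is the exterior normal to Ω (for w = ∞ this means Q₀ = Q_s on |x| = 1). -/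

import Mathlib

open MeasureTheory Filter Metric Real Set
open scoped ENNReal NNReal
noncomputable section

abbrev E3 : Type := EuclideanSpace ℝ (Fin 3)
abbrev Mat3 : Type := Matrix (Fin 3) (Fin 3) ℝ

def isS0 (Q : Mat3) : Prop := Q.IsSymm ∧ Q.trace = 0
def minner (A B : Mat3) : ℝ := (A * B).trace
def mnormSq (A : Mat3) : ℝ := (A * A).trace
def mnorm (A : Mat3) : ℝ := Real.sqrt (mnormSq A)
def outer (u v : E3) : Mat3 := Matrix.of fun i j => u i * v j
def ez : E3 := EuclideanSpace.single 2 1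
def er (x : E3) : E3 := ‖x‖⁻¹ • x
def sstar (a b c : ℝ) : ℝ := (b + Real.sqrt (b ^ 2 + 24 * a * c)) / (4 * c)
def Qinf (a b c : ℝ) : Mat3 := sstar a b c • (outer ez ez - (1 / 3 : ℝ) • (1 : Mat3))
def Qsurf (a b c : ℝ) (x : E3) : Mat3 :=
  sstar a b c • (outer (er x) (er x) - (1 / 3 : ℝ) • (1 : Mat3))
def Omega : Set E3 := {x | 1 < ‖x‖}
def OmegaBar : Set E3 := {x | 1 ≤ ‖x‖}

def pd (g : E3 → ℝ) (k : Fin 3) : E3 → ℝ :=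
  fun x => fderivWithin ℝ g OmegaBar x (EuclideanSpace.single k 1)
def lap3 (g : E3 → ℝ) (x : E3) : ℝ := ∑ k, pd (pd g k) k x
def matLap (Q : E3 → Mat3) (x : E3) : Mat3 := Matrix.of fun i j => lap3 (fun y => Q y i j) x
def gradSq (Q : E3 → Mat3) (x : E3) : ℝ := ∑ i, ∑ j, ∑ k, (pd (fun y => Q y i j) k x) ^ 2
def nuDeriv (Q : E3 → Mat3) (x : E3) : Mat3 :=
  Matrix.of fun i j => fderivWithin ℝ (fun y => Q y i j) OmegaBar x (-(er x))

def gradf (a b c : ℝ) (Q : Mat3) : Mat3 :=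
  (-a) • Q - b • (Q * Q - (mnormSq Q / 3) • (1 : Mat3)) + (c * mnormSq Q) • Q

def gpot (a b c : ℝ) (Q : Mat3) : ℝ :=
  -(a / 2) * (Q * Q).trace - (b / 3) * (Q * Q * Q).trace + (c / 4) * ((Q * Q).trace) ^ 2
def Cconst (a b c : ℝ) : ℝ := -sInf (gpot a b c '' {Q | isS0 Q})
def fpot (a b c : ℝ) (Q : Mat3) : ℝ := gpot a b c Q + Cconst a b c

def RegC (m : ℕ) (Q : E3 → Mat3) : Prop :=
  ∀ i j, ContDiffOn ℝ m (fun x => Q x i j) OmegaBar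

def memH (a b c : ℝ) (Q : E3 → Mat3) : Prop :=
  (∀ x ∈ OmegaBar, isS0 (Q x)) ∧
  IntegrableOn (fun x => gradSq Q x) Omega volume ∧
  IntegrableOn (fun x => mnormSq (Q x - Qinf a b c) / ‖x‖ ^ 2) Omega volume

def isEL (a b c L : ℝ) (Q : E3 → Mat3) : Prop :=
  ∀ x ∈ Omega, L • matLap Q x = gradf a b c (Q x)

def weakAnchor (a b c L W : ℝ) (Q : E3 → Mat3) : Prop :=
  ∀ x : E3, ‖x‖ = 1 → (L / W) • nuDeriv Q x = Qsurf a b c x - Q x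

def coef1 (w : ℝ≥0∞) : ℝ := if w = ⊤ then 1 else w.toReal / (1 + w.toReal)
def coef3 (w : ℝ≥0∞) : ℝ := if w = ⊤ then 1 else w.toReal / (3 + w.toReal)

def Q0 (a b c : ℝ) (w : ℝ≥0∞) (x : E3) : Mat3 :=
  (sstar a b c * coef3 w / ‖x‖ ^ 3) • (outer (er x) (er x) - (1 / 3 : ℝ) • (1 : Mat3))
  + (sstar a b c * (1 - coef1 w / ‖x‖)) • (outer ez ez - (1 / 3 : ℝ) • (1 : Mat3))

def repeatedEig (Q : Mat3) : Prop := ∃ t : ℝ, 2 ≤ Polynomial.rootMultiplicity t (Matrix.charpoly Q)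

def vec3 (p q r : ℝ) : E3 := (WithLp.equiv 2 (Fin 3 → ℝ)).symm ![p, q, r]

theorem uniqueDiffOn_OmegaBar : UniqueDiffOn ℝ OmegaBar := by
  intro x hx
  have hx1 : 1 ≤ ‖x‖ := hx
  have hr : ‖x‖ ≠ 0 := by positivity
  have hsub : ball ((2 : ℝ) • x) ‖x‖ ⊆ OmegaBar := by
    intro y hy
    rw [mem_ball, dist_eq_norm, norm_sub_rev] at hy
    have h1 := norm_sub_norm_le ((2 : ℝ) • x) y
    rw [norm_smul, Real.norm_eq_abs, abs_of_pos (by norm_num : (0 : ℝ) < 2)] at h1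
    have h2 : 0 < ‖y‖ := by linarith
    by_contra hlt
    have hy1 : ‖y‖ < 1 := not_le.mp hlt
    linarith
  refine UniqueDiffWithinAt.mono ?_ hsub
  refine uniqueDiffWithinAt_convex (convex_ball _ _) ?_ ?_
  · rw [isOpen_ball.interior_eq]
    exact ⟨_, mem_ball_self (by positivity)⟩
  · rw [closure_ball _ hr, mem_closedBall, dist_eq_norm, two_smul]
    simp

theorem fderivWithin_OmegaBar_eq {f : E3 → ℝ} {f' : E3 →L[ℝ] ℝ} {x : E3}
    (h : HasFDerivAt f f' x) (hx : x ∈ OmegaBar) : fderivWithin ℝ f OmegaBar x = f' :=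
  h.hasFDerivWithinAt.fderivWithin (uniqueDiffOn_OmegaBar x hx)

theorem ne_zero_of_mem_OmegaBar {x : E3} (hx : x ∈ OmegaBar) : x ≠ 0 := by
  have hx1 : 1 ≤ ‖x‖ := hx
  exact norm_pos_iff.mp (by linarith)

theorem Omega_subset_OmegaBar : Omega ⊆ OmegaBar := fun x hx => le_of_lt (show 1 < ‖x‖ from hx)

theorem hasFDerivAt_norm_inv {x : E3} (hx : x ≠ 0) :
    HasFDerivAt (fun y : E3 => ‖y‖⁻¹) (-(‖x‖⁻¹ ^ 3) • innerSL ℝ x) x := by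
  have hr : ‖x‖ ≠ 0 := norm_ne_zero_iff.mpr hx
  have hsq : HasFDerivAt (fun y : E3 => ‖y‖ ^ 2) (2 • innerSL ℝ x) x :=
    (hasStrictFDerivAt_norm_sq x).hasFDerivAt
  have hnorm := hsq.sqrt (pow_ne_zero 2 hr)
  simp only [Real.sqrt_sq (norm_nonneg _)] at hnorm
  have h := (hasDerivAt_inv hr).comp_hasFDerivAt x hnorm
  refine h.congr_fderiv ?_
  ext v
  simp
  field_simp

theorem hasFDerivAt_coord (i : Fin 3) (x : E3) :
    HasFDerivAt (fun y : E3 => y i) (EuclideanSpace.proj i : E3 →L[ℝ] ℝ) x :=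
  (EuclideanSpace.proj i : E3 →L[ℝ] ℝ).hasFDerivAt

/-- The scalar function of which the entries of `Q0` are instances. -/
def profile (A B C d : ℝ) (i j : Fin 3) (x : E3) : ℝ :=
  A * (x i * x j * ‖x‖⁻¹ ^ 5 - d * ‖x‖⁻¹ ^ 3) + (B - C * ‖x‖⁻¹)

/-- The `k`-th partial derivative of `profile`. -/
def profileGrad (A C d : ℝ) (i j k : Fin 3) (x : E3) : ℝ :=
  A * (((if i = k then 1 else 0) * x j + (if j = k then 1 else 0) * x i) * ‖x‖⁻¹ ^ 5
    - 5 * (x i * x j * x k * ‖x‖⁻¹ ^ 7) + 3 * d * (x k * ‖x‖⁻¹ ^ 5)) + C * (x k * ‖x‖⁻¹ ^ 3)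

theorem fderivWithin_profile (A B C d : ℝ) (i j : Fin 3) {x : E3} (hx : x ∈ OmegaBar) (v : E3) :
    fderivWithin ℝ (profile A B C d i j) OmegaBar x v =
      A * ((v i * x j + x i * v j) * ‖x‖⁻¹ ^ 5 - 5 * (x i * x j * inner ℝ x v * ‖x‖⁻¹ ^ 7)
        + 3 * d * (inner ℝ x v * ‖x‖⁻¹ ^ 5)) + C * (inner ℝ x v * ‖x‖⁻¹ ^ 3) := by
  have hρ := hasFDerivAt_norm_inv (ne_zero_of_mem_OmegaBar hx)
  have h : HasFDerivAt (profile A B C d i j) _ x :=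
    (((((hasFDerivAt_coord i x).fun_mul (hasFDerivAt_coord j x)).fun_mul (hρ.pow 5)).fun_sub
      ((hρ.pow 3).const_mul d)).const_mul A).fun_add ((hρ.const_mul C).const_sub B)
  rw [fderivWithin_OmegaBar_eq h hx]
  simp
  ring

theorem pd_profile (A B C d : ℝ) (i j k : Fin 3) {x : E3} (hx : x ∈ OmegaBar) :
    pd (profile A B C d i j) k x = profileGrad A C d i j k x := by
  rw [pd, fderivWithin_profile A B C d i j hx, profileGrad]
  simp [EuclideanSpace.inner_single_right]

theorem pd_profileGrad (A C d : ℝ) (i j k : Fin 3) {x : E3} (hx : x ∈ OmegaBar) :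
    pd (profileGrad A C d i j k) k x =
      A * (2 * (if i = k then 1 else 0) * (if j = k then 1 else 0) * ‖x‖⁻¹ ^ 5
        - 10 * ((if i = k then 1 else 0) * x j + (if j = k then 1 else 0) * x i) * x k * ‖x‖⁻¹ ^ 7
        - 5 * x i * x j * ‖x‖⁻¹ ^ 7 + 35 * x i * x j * x k ^ 2 * ‖x‖⁻¹ ^ 9
        + 3 * d * (‖x‖⁻¹ ^ 5 - 5 * x k ^ 2 * ‖x‖⁻¹ ^ 7))
      + C * (‖x‖⁻¹ ^ 3 - 3 * x k ^ 2 * ‖x‖⁻¹ ^ 5) := by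
  have hρ := hasFDerivAt_norm_inv (ne_zero_of_mem_OmegaBar hx)
  have hi := hasFDerivAt_coord i x
  have hj := hasFDerivAt_coord j x
  have hk := hasFDerivAt_coord k x
  have h : HasFDerivAt (profileGrad A C d i j k) _ x :=
    ((((((hj.const_mul (if i = k then 1 else 0)).fun_add
        (hi.const_mul (if j = k then 1 else 0))).fun_mul (hρ.pow 5)).fun_sub
      ((((hi.fun_mul hj).fun_mul hk).fun_mul (hρ.pow 7)).const_mul 5)).fun_add
      ((hk.fun_mul (hρ.pow 5)).const_mul (3 * d))).const_mul A).fun_add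
      ((hk.fun_mul (hρ.pow 3)).const_mul C)
  rw [pd, fderivWithin_OmegaBar_eq h hx]
  by_cases hik : i = k <;> by_cases hjk : j = k <;>
    simp [EuclideanSpace.inner_single_right, hik, hjk] <;> ring

theorem norm_inv_sq_mul_sum_sq {x : E3} (hx : x ≠ 0) :
    ‖x‖⁻¹ ^ 2 * (x 0 ^ 2 + x 1 ^ 2 + x 2 ^ 2) = 1 := by
  have hr : ‖x‖ ≠ 0 := norm_ne_zero_iff.mpr hx
  have h := EuclideanSpace.real_norm_sq_eq x
  rw [Fin.sum_univ_three] at h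
  rw [← h]
  field_simp

theorem lap3_profile (A B C : ℝ) (i j : Fin 3) {x : E3} (hx : x ∈ OmegaBar) :
    lap3 (profile A B C ((if i = j then 1 else 0) / 3) i j) x = 0 := by
  set d : ℝ := (if i = j then 1 else 0) / 3 with hd
  have hcongr : ∀ k, pd (pd (profile A B C d i j) k) k x = pd (profileGrad A C d i j k) k x := by
    intro k
    have hEq : EqOn (pd (profile A B C d i j) k) (profileGrad A C d i j k) OmegaBar :=
      fun y hy => pd_profile A B C d i j k hy
    rw [pd, fderivWithin_congr hEq (hEq hx), ← pd]
  have h := norm_inv_sq_mul_sum_sq (ne_zero_of_mem_OmegaBar hx)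
  simp only [lap3, hcongr, pd_profileGrad A C d i j _ hx, Fin.sum_univ_three]
  have hδδ : ∑ k, (if i = k then 1 else 0 : ℝ) * (if j = k then 1 else 0) = 3 * d := by
    simp [hd]
    ring
  have hδ : ∀ l : Fin 3, ∑ k, (if l = k then 1 else 0 : ℝ) * x k = x l := by
    simp
  have hi := hδ i
  have hj := hδ j
  rw [Fin.sum_univ_three] at hδδ hi hj
  linear_combination (35 * A * x i * x j * ‖x‖⁻¹ ^ 7 - 15 * A * d * ‖x‖⁻¹ ^ 5
    - 3 * C * ‖x‖⁻¹ ^ 3) * h + 2 * A * ‖x‖⁻¹ ^ 5 * hδδ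
    - 10 * A * ‖x‖⁻¹ ^ 7 * (x j * hi + x i * hj)

theorem Q0_apply (a b c : ℝ) (w : ℝ≥0∞) (i j : Fin 3) :
    (fun x => Q0 a b c w x i j) = profile (sstar a b c * coef3 w) (Qinf a b c i j)
      (coef1 w * Qinf a b c i j) ((if i = j then 1 else 0) / 3) i j := by
  funext x
  simp only [Q0, Qinf, profile, outer, er, Matrix.add_apply, Matrix.smul_apply, Matrix.sub_apply,
    Matrix.of_apply, Matrix.one_apply, PiLp.smul_apply, smul_eq_mul]
  ring

theorem abs_coord_mul_norm_inv_le (x : E3) (i : Fin 3) : |x i * ‖x‖⁻¹| ≤ 1 := by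
  rw [abs_mul, abs_inv, abs_norm, ← div_eq_mul_inv]
  exact div_le_one_of_le₀ (PiLp.norm_apply_le x i) (norm_nonneg x)

theorem abs_profileGrad_le (A C d : ℝ) (i j k : Fin 3) {x : E3} (hx : x ∈ OmegaBar) :
    |profileGrad A C d i j k x| ≤ (|A| * (7 + 3 * |d|) + |C|) * ‖x‖⁻¹ ^ 2 := by
  have hx1 : 1 ≤ ‖x‖ := hx
  have hρ0 : 0 ≤ ‖x‖⁻¹ := by positivity
  have hρ1 : ‖x‖⁻¹ ≤ 1 := inv_le_one_of_one_le₀ hx1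
  have hi := abs_coord_mul_norm_inv_le x i
  have hj := abs_coord_mul_norm_inv_le x j
  have hk := abs_coord_mul_norm_inv_le x k
  have hform : profileGrad A C d i j k x =
      (A * (((if i = k then 1 else 0) * (x j * ‖x‖⁻¹) + (if j = k then 1 else 0) * (x i * ‖x‖⁻¹))
        - 5 * ((x i * ‖x‖⁻¹) * (x j * ‖x‖⁻¹) * (x k * ‖x‖⁻¹)) + 3 * d * (x k * ‖x‖⁻¹))
        * ‖x‖⁻¹ ^ 2 + C * (x k * ‖x‖⁻¹)) * ‖x‖⁻¹ ^ 2 := by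
    rw [profileGrad]; ring
  have hδ : ∀ l m : Fin 3, |(if l = m then 1 else 0 : ℝ)| ≤ 1 := by
    intro l m; split_ifs <;> simp
  have hbd : |((if i = k then 1 else 0) * (x j * ‖x‖⁻¹) + (if j = k then 1 else 0) * (x i * ‖x‖⁻¹))
        - 5 * ((x i * ‖x‖⁻¹) * (x j * ‖x‖⁻¹) * (x k * ‖x‖⁻¹)) + 3 * d * (x k * ‖x‖⁻¹)|
      ≤ 1 * 1 + 1 * 1 + 5 * (1 * 1 * 1) + 3 * |d| * 1 := by
    refine (abs_add_le _ _).trans (add_le_add ((abs_sub _ _).trans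
      (add_le_add ((abs_add_le _ _).trans (add_le_add ?_ ?_)) ?_)) ?_)
    · rw [abs_mul]; gcongr; exact hδ i k
    · rw [abs_mul]; gcongr; exact hδ j k
    · rw [abs_mul, abs_mul, abs_mul, abs_of_pos (by norm_num : (0 : ℝ) < 5)]; gcongr
    · rw [abs_mul, abs_mul, abs_of_pos (by norm_num : (0 : ℝ) < 3)]; gcongr
  rw [hform, abs_mul, abs_of_nonneg (pow_nonneg hρ0 2)]
  gcongr
  refine (abs_add_le _ _).trans (add_le_add ?_ ?_)
  · rw [abs_mul, abs_mul, abs_of_nonneg (pow_nonneg hρ0 2)]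
    calc _ ≤ |A| * (1 * 1 + 1 * 1 + 5 * (1 * 1 * 1) + 3 * |d| * 1) * 1 := by
          gcongr
          exact pow_le_one₀ hρ0 hρ1
      _ = _ := by ring
  · rw [abs_mul]
    exact mul_le_of_le_one_right (abs_nonneg C) hk

theorem measurableSet_Omega : MeasurableSet Omega :=
  (isOpen_lt continuous_const continuous_norm).measurableSet

theorem continuousOn_norm_inv : ContinuousOn (fun x : E3 => ‖x‖⁻¹) Omega :=
  continuous_norm.continuousOn.inv₀ fun _ hx =>
    norm_ne_zero_iff.mpr (ne_zero_of_mem_OmegaBar (Omega_subset_OmegaBar hx))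

theorem continuousOn_profile (A B C d : ℝ) (i j : Fin 3) :
    ContinuousOn (profile A B C d i j) Omega := by
  have := continuousOn_norm_inv
  unfold profile
  fun_prop

theorem continuousOn_profileGrad (A C d : ℝ) (i j k : Fin 3) :
    ContinuousOn (profileGrad A C d i j k) Omega := by
  have := continuousOn_norm_inv
  unfold profileGrad
  fun_prop

theorem integrableOn_Omega_of_abs_le {f : E3 → ℝ} (K : ℝ) (hf : ContinuousOn f Omega)
    (hK : ∀ x ∈ Omega, |f x| ≤ K * ‖x‖⁻¹ ^ 4) : IntegrableOn f Omega volume := by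
  have hint : Integrable (fun x : E3 => |K| * 16 * (1 + ‖x‖) ^ (-(4 : ℝ))) volume :=
    (integrable_one_add_norm (by simp; norm_num)).const_mul _
  refine Integrable.mono' hint.integrableOn (hf.aestronglyMeasurable measurableSet_Omega) ?_
  refine (ae_restrict_iff' measurableSet_Omega).mpr (Eventually.of_forall fun x hx => ?_)
  have hx1 : 1 < ‖x‖ := hx
  have hle : ‖x‖⁻¹ ≤ 2 * (1 + ‖x‖)⁻¹ := by
    rw [← div_eq_mul_inv, inv_eq_one_div, div_le_div_iff₀ (by positivity) (by positivity)]
    linarith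
  rw [Real.norm_eq_abs, Real.rpow_neg (by positivity)]
  calc |f x| ≤ K * ‖x‖⁻¹ ^ 4 := hK x hx
    _ ≤ |K| * (2 * (1 + ‖x‖)⁻¹) ^ 4 := by
        gcongr
        exact le_abs_self K
    _ = |K| * 16 * ((1 + ‖x‖) ^ (4 : ℝ))⁻¹ := by
        rw [show (4 : ℝ) = ((4 : ℕ) : ℝ) by norm_num, Real.rpow_natCast, mul_pow, inv_pow]
        ring

theorem integrableOn_finset_sum {ι : Type*} (s : Finset ι) {f : ι → E3 → ℝ}
    (h : ∀ i ∈ s, IntegrableOn (f i) Omega volume) :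
    IntegrableOn (fun x => ∑ i ∈ s, f i x) Omega volume :=
  integrable_finsetSum s h

theorem integrableOn_gradSq_Q0 (a b c : ℝ) (w : ℝ≥0∞) :
    IntegrableOn (fun x => gradSq (Q0 a b c w) x) Omega volume := by
  unfold gradSq
  refine integrableOn_finset_sum _ fun i _ => integrableOn_finset_sum _ fun j _ =>
    integrableOn_finset_sum _ fun k _ => ?_
  rw [Q0_apply]
  set A := sstar a b c * coef3 w
  set C := coef1 w * Qinf a b c i j
  set d : ℝ := (if i = j then 1 else 0) / 3
  have hint : IntegrableOn (fun x => profileGrad A C d i j k x ^ 2) Omega volume := by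
    refine integrableOn_Omega_of_abs_le ((|A| * (7 + 3 * |d|) + |C|) ^ 2)
      ((continuousOn_profileGrad A C d i j k).pow 2) fun x hx => ?_
    have h := abs_profileGrad_le A C d i j k (Omega_subset_OmegaBar hx)
    calc |profileGrad A C d i j k x ^ 2| = |profileGrad A C d i j k x| ^ 2 := abs_pow _ _
      _ ≤ ((|A| * (7 + 3 * |d|) + |C|) * ‖x‖⁻¹ ^ 2) ^ 2 := by gcongr
      _ = _ := by ring
  refine hint.congr_fun (fun x hx => ?_) measurableSet_Omega
  simp only [pd_profile A _ C d i j k (Omega_subset_OmegaBar hx)]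

theorem isSymm_outer_self_sub (u : E3) (t : ℝ) : (outer u u - t • (1 : Mat3)).IsSymm := by
  ext i j
  simp [outer, Matrix.one_apply, mul_comm, eq_comm]

theorem trace_outer_self_sub {u : E3} (hu : ‖u‖ = 1) :
    (outer u u - (1 / 3 : ℝ) • (1 : Mat3)).trace = 0 := by
  have h := EuclideanSpace.real_norm_sq_eq u
  rw [hu, Fin.sum_univ_three] at h
  simp [Matrix.trace, outer, Fin.sum_univ_three]
  linarith

theorem isS0_Q0 (a b c : ℝ) (w : ℝ≥0∞) {x : E3} (hx : x ∈ OmegaBar) : isS0 (Q0 a b c w x) := by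
  have hx1 : 1 ≤ ‖x‖ := hx
  have her : ‖er x‖ = 1 := by
    rw [er, norm_smul, norm_inv, norm_norm, inv_mul_cancel₀ (by positivity)]
  have hez : ‖ez‖ = 1 := by simp [ez]
  constructor
  · exact ((isSymm_outer_self_sub _ _).smul _).add ((isSymm_outer_self_sub _ _).smul _)
  · rw [Q0, Matrix.trace_add, Matrix.trace_smul, Matrix.trace_smul, trace_outer_self_sub her,
      trace_outer_self_sub hez]
    simp

theorem abs_profile_sub_le (A B C d : ℝ) (i j : Fin 3) {x : E3} (hx : x ∈ OmegaBar) :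
    |profile A B C d i j x - B| ≤ (|A| * (1 + |d|) + |C|) * ‖x‖⁻¹ := by
  have hx1 : 1 ≤ ‖x‖ := hx
  have hρ0 : 0 ≤ ‖x‖⁻¹ := by positivity
  have hρ1 : ‖x‖⁻¹ ≤ 1 := inv_le_one_of_one_le₀ hx1
  have hi := abs_coord_mul_norm_inv_le x i
  have hj := abs_coord_mul_norm_inv_le x j
  have hform : profile A B C d i j x - B =
      (A * ((x i * ‖x‖⁻¹) * (x j * ‖x‖⁻¹) - d) * ‖x‖⁻¹ ^ 2 - C) * ‖x‖⁻¹ := by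
    rw [profile]; ring
  rw [hform, abs_mul, abs_of_nonneg hρ0]
  gcongr
  refine (abs_sub _ _).trans (add_le_add ?_ le_rfl)
  rw [abs_mul, abs_mul, abs_of_nonneg (pow_nonneg hρ0 2)]
  have hbd : |(x i * ‖x‖⁻¹) * (x j * ‖x‖⁻¹) - d| ≤ 1 * 1 + |d| := by
    refine (abs_sub _ _).trans (add_le_add ?_ le_rfl)
    rw [abs_mul]
    gcongr
  calc _ ≤ |A| * (1 * 1 + |d|) * 1 := by
        gcongr
        exact pow_le_one₀ hρ0 hρ1
    _ = _ := by ring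

theorem integrableOn_hardy_Q0 (a b c : ℝ) (w : ℝ≥0∞) :
    IntegrableOn (fun x => mnormSq (Q0 a b c w x - Qinf a b c) / ‖x‖ ^ 2) Omega volume := by
  simp only [mnormSq, Matrix.trace, Matrix.diag, Matrix.mul_apply, Finset.sum_div]
  refine integrableOn_finset_sum _ fun i _ => integrableOn_finset_sum _ fun j _ => ?_
  have hQ : ∀ k l x, Q0 a b c w x k l = profile (sstar a b c * coef3 w) (Qinf a b c k l)
      (coef1 w * Qinf a b c k l) ((if k = l then 1 else 0) / 3) k l x :=
    fun k l x => congrFun (Q0_apply a b c w k l) x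
  simp only [Matrix.sub_apply, hQ, div_eq_mul_inv _ (‖_‖ ^ 2), ← inv_pow]
  set A := sstar a b c * coef3 w
  refine integrableOn_Omega_of_abs_le
    ((|A| * (1 + |(if i = j then 1 else 0) / 3|) + |coef1 w * Qinf a b c i j|)
      * (|A| * (1 + |(if j = i then 1 else 0) / 3|) + |coef1 w * Qinf a b c j i|)) ?_ ?_
  · exact (((continuousOn_profile _ _ _ _ i j).sub continuousOn_const).mul
      ((continuousOn_profile _ _ _ _ j i).sub continuousOn_const)).mul
      (continuousOn_norm_inv.pow 2)
  · intro x hx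
    have hx' := Omega_subset_OmegaBar hx
    rw [abs_mul, abs_mul, abs_of_nonneg (by positivity : 0 ≤ ‖x‖⁻¹ ^ 2)]
    calc _ ≤ ((|A| * (1 + |(if i = j then 1 else 0) / 3|) + |coef1 w * Qinf a b c i j|) * ‖x‖⁻¹)
          * ((|A| * (1 + |(if j = i then 1 else 0) / 3|) + |coef1 w * Qinf a b c j i|) * ‖x‖⁻¹)
          * ‖x‖⁻¹ ^ 2 := by
          gcongr
          · exact abs_profile_sub_le _ _ _ _ i j hx'
          · exact abs_profile_sub_le _ _ _ _ j i hx'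
      _ = _ := by ring

theorem nuDeriv_Q0 (a b c : ℝ) (w : ℝ≥0∞) {x : E3} (hx : ‖x‖ = 1) :
    nuDeriv (Q0 a b c w) x =
      (3 * coef3 w) • Qsurf a b c x - coef1 w • Qinf a b c := by
  ext i j
  have hxB : x ∈ OmegaBar := hx.ge
  have hinner : inner ℝ x (-(er x)) = -1 := by
    rw [er, hx, inv_one, one_smul, inner_neg_right, real_inner_self_eq_norm_sq, hx]
    norm_num
  rw [nuDeriv, Matrix.of_apply, Q0_apply, fderivWithin_profile _ _ _ _ i j hxB, hinner]
  simp [er, hx, Qsurf, outer, Matrix.one_apply]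
  split_ifs <;> ring

theorem Q0_eq_on_sphere (a b c : ℝ) (w : ℝ≥0∞) {x : E3} (hx : ‖x‖ = 1) :
    Q0 a b c w x = coef3 w • Qsurf a b c x + (1 - coef1 w) • Qinf a b c := by
  simp only [Q0, hx, Qsurf, Qinf, one_pow, div_one, smul_smul]
  congr 2 <;> ring

/-- the explicit map `Q₀ = Q_{0,w}` belongs to `H_∞` (S₀-valued with finite
Dirichlet and Hardy integrals), is entrywise harmonic in `Ω`, and satisfies the Robin
boundary condition `(1/w) ∂Q₀/∂ν = Q_s − Q₀` on the unit sphere (Dirichlet `Q₀ = Q_s`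
when `w = ∞`). -/
theorem Q0_harmonic_robin
    (a b c : ℝ) (ha : 0 ≤ a) (hb : 0 < b) (hc : 0 < c)
    (w : ℝ≥0∞) (hw : 0 < w) :
    (∀ x ∈ OmegaBar, isS0 (Q0 a b c w x)) ∧
    IntegrableOn (fun x => gradSq (Q0 a b c w) x) Omega volume ∧
    IntegrableOn (fun x => mnormSq (Q0 a b c w x - Qinf a b c) / ‖x‖ ^ 2) Omega volume ∧
    (∀ i j, ∀ x ∈ Omega, lap3 (fun y => Q0 a b c w y i j) x = 0) ∧
    (w ≠ ⊤ → ∀ x : E3, ‖x‖ = 1 →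
      (1 / w.toReal) • nuDeriv (Q0 a b c w) x = Qsurf a b c x - Q0 a b c w x) ∧
    (w = ⊤ → ∀ x : E3, ‖x‖ = 1 → Q0 a b c w x = Qsurf a b c x) := by
  refine ⟨fun x hx => isS0_Q0 a b c w hx, integrableOn_gradSq_Q0 a b c w,
    integrableOn_hardy_Q0 a b c w, fun i j x hx => ?_, fun hw' x hx => ?_, fun hw' x hx => ?_⟩
  · rw [Q0_apply]
    exact lap3_profile _ _ _ i j (Omega_subset_OmegaBar hx)
  · have ht : 0 < w.toReal := ENNReal.toReal_pos hw.ne' hw'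
    have h1 : 1 / w.toReal * (3 * coef3 w) = 1 - coef3 w := by
      rw [coef3, if_neg hw']; field_simp; ring
    have h2 : 1 / w.toReal * coef1 w = 1 - coef1 w := by
      rw [coef1, if_neg hw']; field_simp; ring
    rw [nuDeriv_Q0 a b c w hx, Q0_eq_on_sphere a b c w hx, smul_sub, smul_smul, smul_smul, h1, h2,
      sub_smul 1 (coef3 w), one_smul]
    abel
  · rw [Q0_eq_on_sphere a b c w hx, coef3, coef1, if_pos hw', if_pos hw']
    simp
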